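/- For every λ ∈ [−1, 1] and every real c > −1: (1/√(2π)) · ∫₀^∞ τ^c · ( e^{−(τ−λ)²/2} − e^{−(τ+λ)²/2} ) dτ = γ_{c+1}^{c+1} · λ · ₁F₁((1−c)/2; 3/2; −λ²/2). -/

import Mathlib

noncomputable section

open MeasureTheory Real Set

/-- The `r`-th Gaussian norm: `γ_r = (∫ |x|^r (2π)^{-1/2} e^{-x²/2} dx)^{1/r}`. -/
def gaussNorm (r : ℝ) : ℝ :=
  (∫ x : ℝ, |x| ^ r * ((Real.sqrt (2 * Real.pi))⁻¹ * Real.exp (-x ^ 2 / 2))) ^ (1 / r)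

/-- The rising factorial `(x)_k = x (x+1) ⋯ (x+k−1)`. -/
def risingFac (x : ℝ) : ℕ → ℝ
  | 0 => 1
  | k + 1 => risingFac x k * (x + k)

/-- The confluent hypergeometric function `₁F₁(α;β;z) = Σ_k (α)_k/((β)_k k!) z^k`. -/
def oneF1 (α β z : ℝ) : ℝ :=
  ∑' k : ℕ, risingFac α k / (risingFac β k * (Nat.factorial k)) * z ^ k

lemma risingFac_pos {x : ℝ} (hx : 0 < x) (k : ℕ) : 0 < risingFac x k := by
  induction k with
  | zero => simp [risingFac]
  | succ k ih => simp only [risingFac]; positivity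

lemma risingFac_succ_left (x : ℝ) (k : ℕ) : risingFac x (k + 1) = x * risingFac (x + 1) k := by
  induction k with
  | zero => simp [risingFac]
  | succ k ih =>
    rw [risingFac, ih]
    simp only [risingFac]
    push_cast
    ring

lemma chu (n : ℕ) : ∀ a b : ℝ, 0 < b →
    ∑ k ∈ Finset.range (n + 1), (-1 : ℝ) ^ k * (n.choose k) * (risingFac a k / risingFac b k)
      = risingFac (b - a) n / risingFac b n := by
  induction n with
  | zero => intro a b hb; simp [risingFac]
  | succ n ih =>
    intro a b hb
    have h1 := ih a b hb
    have h2 := ih (a + 1) (b + 1) (by linarith)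
    have e : (b + 1 - (a + 1)) = b - a := by ring
    rw [e] at h2
    have hsplit : ∑ k ∈ Finset.range (n + 1 + 1),
        (-1 : ℝ) ^ k * ((n + 1).choose k) * (risingFac a k / risingFac b k)
        = (∑ k ∈ Finset.range (n + 1), (-1 : ℝ) ^ k * (n.choose k) * (risingFac a k / risingFac b k))
        - a / b * ∑ k ∈ Finset.range (n + 1),
          (-1 : ℝ) ^ k * (n.choose k) * (risingFac (a + 1) k / risingFac (b + 1) k) := by
      have h3 : ∑ k ∈ Finset.range (n + 1), (-1 : ℝ) ^ k * (n.choose k) * (risingFac a k / risingFac b k)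
          = ∑ k ∈ Finset.range (n + 1 + 1), (-1 : ℝ) ^ k * (n.choose k) * (risingFac a k / risingFac b k) := by
        rw [Finset.sum_range_succ _ (n + 1)]
        simp
      rw [h3, Finset.sum_range_succ', Finset.sum_range_succ' _ (n + 1), Finset.mul_sum]
      rw [add_sub_right_comm, ← Finset.sum_sub_distrib]
      congr 1
      · apply Finset.sum_congr rfl
        intro k _
        rw [risingFac_succ_left, risingFac_succ_left, Nat.choose_succ_succ]
        have := (risingFac_pos (show 0 < b + 1 by linarith) k).ne'
        push_cast
        field_simp
        ring
      · simp
    rw [hsplit, h1, h2]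
    have p1 := (risingFac_pos hb n).ne'
    have p2 := (risingFac_pos (show 0 < b + 1 by linarith) n).ne'
    have h4 := risingFac_succ_left b n
    have h5 : a / b * (risingFac (b - a) n / risingFac (b + 1) n)
        = a * risingFac (b - a) n / risingFac b (n + 1) := by
      rw [h4]; field_simp
    rw [h5]
    simp only [risingFac]
    have : b + n ≠ 0 := by positivity
    field_simp
    ring

lemma F_summable {a b z : ℝ} (ha : 0 < a) (hb : 1 ≤ b) (hz : 0 ≤ z) :
    Summable (fun k : ℕ => risingFac a k / (risingFac b k * (Nat.factorial k)) * z ^ k) := by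
  have hb0 : 0 < b := by linarith
  have key : ∀ k, risingFac a k ≤ (1 + a) ^ k * risingFac b k := by
    intro k
    induction k with
    | zero => simp [risingFac]
    | succ k ih =>
      simp only [risingFac]
      have h1 : a + k ≤ (1 + a) * (b + k) := by
        have : (0 : ℝ) ≤ k := by positivity
        nlinarith [mul_nonneg ha.le this, mul_nonneg ha.le (sub_nonneg.2 hb)]
      calc risingFac a k * (a + k) ≤ ((1 + a) ^ k * risingFac b k) * ((1 + a) * (b + k)) := by
            have := risingFac_pos hb0 k
            gcongr
        _ = _ := by ring
  refine Summable.of_nonneg_of_le (fun k => ?_) (fun k => ?_)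
    (Real.summable_pow_div_factorial ((1 + a) * z))
  · have := risingFac_pos ha k
    have := risingFac_pos hb0 k
    positivity
  · have h1 := risingFac_pos hb0 k
    have hf : (0 : ℝ) < Nat.factorial k := by positivity
    rw [mul_pow, div_mul_eq_mul_div, div_le_div_iff₀ (by positivity) hf]
    have := mul_le_mul_of_nonneg_right (key k) (show 0 ≤ z ^ k * (Nat.factorial k : ℝ) by positivity)
    linarith

lemma kummer {a b z : ℝ} (ha : 0 < a) (hb : 1 ≤ b) (hz : 0 ≤ z) :
    Real.exp (-z) * oneF1 a b z = oneF1 (b - a) b (-z) := by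
  have hb0 : 0 < b := by linarith
  have hF := F_summable ha hb hz
  have hE := Real.summable_pow_div_factorial (-z)
  have he : Real.exp (-z) = ∑' n : ℕ, (-z) ^ n / (Nat.factorial n : ℝ) := by
    rw [Real.exp_eq_exp_ℝ, NormedSpace.exp_eq_tsum_div]
  rw [he, mul_comm]
  unfold oneF1
  rw [tsum_mul_tsum_eq_tsum_sum_antidiagonal_of_summable_norm hF.norm hE.norm]
  congr 1
  ext n
  rw [Finset.Nat.sum_antidiagonal_eq_sum_range_succ (fun k j =>
    risingFac a k / (risingFac b k * (Nat.factorial k)) * z ^ k * ((-z) ^ j / (Nat.factorial j : ℝ)))]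
  have := chu n a b hb0
  have h2 : risingFac (b - a) n / (risingFac b n * (Nat.factorial n)) * (-z) ^ n
      = (-z) ^ n / (Nat.factorial n) * (risingFac (b - a) n / risingFac b n) := by
    have := (risingFac_pos hb0 n).ne'
    field_simp
  rw [h2, ← this, Finset.mul_sum]
  apply Finset.sum_congr rfl
  intro k hk
  have hk' : k ≤ n := by simpa [Nat.lt_succ_iff] using hk
  have hp := (risingFac_pos hb0 k).ne'
  rw [Nat.cast_choose ℝ hk']
  have e1 : (-z) ^ n = (-1) ^ k * z ^ k * (-z) ^ (n - k) := by
    rw [← mul_pow, neg_one_mul, ← pow_add, Nat.add_sub_cancel' hk']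
  have e2 : ((-1 : ℝ) ^ k) * (-1) ^ k = 1 := by rw [← mul_pow]; simp
  have f1 : (Nat.factorial n : ℝ) ≠ 0 := by positivity
  have f2 : (Nat.factorial k : ℝ) ≠ 0 := by positivity
  have f3 : (Nat.factorial (n - k) : ℝ) ≠ 0 := by positivity
  rw [e1]
  generalize (-z) ^ (n - k) = w
  have : (-1 : ℝ) ^ k * z ^ k * w / (Nat.factorial n) * ((-1) ^ k * ((Nat.factorial n) / ((Nat.factorial k) * (Nat.factorial (n - k)))) * (risingFac a k / risingFac b k))
    = ((-1 : ℝ) ^ k * (-1) ^ k) * (z ^ k * w / (Nat.factorial n) * (((Nat.factorial n) / ((Nat.factorial k) * (Nat.factorial (n - k)))) * (risingFac a k / risingFac b k))) := by ring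
  rw [this, e2]
  field_simp

/-- half-line Gaussian moment -/
def Mom (s : ℝ) : ℝ := ∫ x in Ioi (0 : ℝ), x ^ s * Real.exp (-x ^ 2 / 2)

lemma Mom_eq {s : ℝ} (hs : -1 < s) :
    Mom s = (1 / 2 : ℝ) ^ (-(s + 1) / 2) * (1 / 2) * Real.Gamma ((s + 1) / 2) := by
  rw [← integral_rpow_mul_exp_neg_mul_rpow (by norm_num : (0 : ℝ) < 2) hs (by norm_num)]
  unfold Mom
  congr 1
  ext x
  rw [Real.rpow_two]
  congr 2
  ring

lemma Mom_int {s : ℝ} (hs : -1 < s) :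
    IntegrableOn (fun x : ℝ => x ^ s * Real.exp (-x ^ 2 / 2)) (Ioi 0) := by
  have := integrableOn_rpow_mul_exp_neg_mul_sq (by norm_num : (0 : ℝ) < 1 / 2) hs
  refine this.congr_fun (fun x _ => ?_) measurableSet_Ioi
  simp only
  congr 2
  ring

lemma Mom_add_two {s : ℝ} (hs : -1 < s) : Mom (s + 2) = (s + 1) * Mom s := by
  rw [Mom_eq hs, Mom_eq (by linarith), show (s + 2 + 1) / 2 = (s + 1) / 2 + 1 by ring,
    Real.Gamma_add_one (by linarith), show -(s + 2 + 1) / 2 = -(s + 1) / 2 + (-1) by ring,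
    Real.rpow_add (by norm_num), Real.rpow_neg_one]
  ring

lemma Mom_iter {c : ℝ} (hc : -1 < c) (k : ℕ) :
    Mom (c + (2 * k + 1 : ℕ)) = 2 ^ k * risingFac ((c + 2) / 2) k * Mom (c + 1) := by
  induction k with
  | zero => simp [risingFac]
  | succ k ih =>
    have : c + ((2 * (k + 1) + 1 : ℕ) : ℝ) = c + (2 * k + 1 : ℕ) + 2 := by push_cast; ring
    have h0 : (0 : ℝ) ≤ ((2 * k + 1 : ℕ) : ℝ) := by positivity
    rw [this, Mom_add_two (by linarith), ih]
    simp only [risingFac]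
    push_cast
    ring

lemma fact_eq (k : ℕ) : ((Nat.factorial (2 * k + 1) : ℕ) : ℝ)
    = 4 ^ k * (Nat.factorial k) * risingFac (3 / 2) k := by
  induction k with
  | zero => simp [risingFac]
  | succ k ih =>
    rw [show 2 * (k + 1) + 1 = (2 * k + 1) + 1 + 1 by ring, Nat.factorial_succ, Nat.factorial_succ,
      Nat.factorial_succ k]
    simp only [risingFac]
    push_cast
    rw [ih]
    ring

lemma coef_eq {c : ℝ} (hc : -1 < c) (l : ℝ) (k : ℕ) :
    l ^ (2 * k + 1) / (Nat.factorial (2 * k + 1) : ℝ) * Mom (c + (2 * k + 1 : ℕ))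
    = Mom (c + 1) * l * (risingFac ((c + 2) / 2) k / (risingFac (3 / 2) k * (Nat.factorial k))
      * (l ^ 2 / 2) ^ k) := by
  rw [Mom_iter hc, fact_eq]
  have := (risingFac_pos (by norm_num : (0 : ℝ) < 3 / 2) k).ne'
  have f2 : (Nat.factorial k : ℝ) ≠ 0 := by positivity
  rw [div_pow, show (4 : ℝ) ^ k = 2 ^ k * 2 ^ k by rw [← mul_pow]; norm_num]
  field_simp
  ring

lemma sinh_int {c : ℝ} (hc : -1 < c) (l : ℝ) :
    ∫ x in Ioi (0 : ℝ), x ^ c * Real.exp (-x ^ 2 / 2) * Real.sinh (l * x)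
      = Mom (c + 1) * l * oneF1 ((c + 2) / 2) (3 / 2) (l ^ 2 / 2) := by
  let F : ℕ → ℝ → ℝ := fun k x => x ^ c * Real.exp (-x ^ 2 / 2) *
    ((l * x) ^ (2 * k + 1) / (Nat.factorial (2 * k + 1) : ℝ))
  have hs : ∀ k : ℕ, -1 < c + (2 * k + 1 : ℕ) := fun k => by
    have h0 : (0 : ℝ) ≤ ((2 * k + 1 : ℕ) : ℝ) := by positivity
    linarith
  have hF : ∀ k, ∀ x ∈ Ioi (0 : ℝ), F k x = l ^ (2 * k + 1) / (Nat.factorial (2 * k + 1) : ℝ) *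
      (x ^ (c + (2 * k + 1 : ℕ)) * Real.exp (-x ^ 2 / 2)) := by
    intro k x hx
    simp only [F]
    rw [Real.rpow_add hx, Real.rpow_natCast, mul_pow]
    ring
  have hFn : ∀ k, ∀ x ∈ Ioi (0 : ℝ), ‖F k x‖ = |l| ^ (2 * k + 1) / (Nat.factorial (2 * k + 1) : ℝ) *
      (x ^ (c + (2 * k + 1 : ℕ)) * Real.exp (-x ^ 2 / 2)) := by
    intro k x hx
    have hx0 : (0 : ℝ) < x := hx
    rw [hF k x hx, norm_mul, norm_div, norm_pow, Real.norm_eq_abs l,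
      Real.norm_of_nonneg (by positivity : (0 : ℝ) ≤ (Nat.factorial (2 * k + 1) : ℝ)),
      Real.norm_of_nonneg (by positivity : 0 ≤ x ^ (c + (2 * k + 1 : ℕ)) * Real.exp (-x ^ 2 / 2))]
  have hint : ∀ k, Integrable (F k) (volume.restrict (Ioi 0)) := by
    intro k
    have h := (Mom_int (hs k)).const_mul (l ^ (2 * k + 1) / (Nat.factorial (2 * k + 1) : ℝ))
    exact IntegrableOn.congr_fun h (fun x hx => (hF k x hx).symm) measurableSet_Ioi
  have hval : ∀ k, ∫ x in Ioi (0 : ℝ), F k x = Mom (c + 1) * l *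
      (risingFac ((c + 2) / 2) k / (risingFac (3 / 2) k * (Nat.factorial k)) * (l ^ 2 / 2) ^ k) := by
    intro k
    rw [setIntegral_congr_fun measurableSet_Ioi (hF k), integral_const_mul, ← coef_eq hc]
    rfl
  have hvaln : ∀ k, ∫ x in Ioi (0 : ℝ), ‖F k x‖ = Mom (c + 1) * |l| *
      (risingFac ((c + 2) / 2) k / (risingFac (3 / 2) k * (Nat.factorial k)) * (|l| ^ 2 / 2) ^ k) := by
    intro k
    rw [setIntegral_congr_fun measurableSet_Ioi (hFn k), integral_const_mul, ← coef_eq hc]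
    rfl
  have hsum : Summable (fun k => ∫ x in Ioi (0 : ℝ), ‖F k x‖) := by
    simp_rw [hvaln]
    exact (F_summable (by linarith) (by norm_num) (by positivity)).mul_left _
  have := integral_tsum_of_summable_integral_norm hint hsum
  have h2 : ∀ x, ∑' k, F k x = x ^ c * Real.exp (-x ^ 2 / 2) * Real.sinh (l * x) := by
    intro x
    exact ((Real.hasSum_sinh (l * x)).mul_left _).tsum_eq
  simp_rw [h2, hval] at this
  rw [← this, tsum_mul_left]
  rfl

lemma gauss_eq {c : ℝ} (hc : -1 < c) :
    gaussNorm (c + 1) ^ (c + 1) = 2 / Real.sqrt (2 * Real.pi) * Mom (c + 1) := by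
  unfold gaussNorm
  rw [← Real.rpow_mul (integral_nonneg fun x => by positivity),
    one_div_mul_cancel (by linarith), Real.rpow_one]
  have := integral_comp_abs (f := fun x : ℝ => x ^ (c + 1) * ((Real.sqrt (2 * Real.pi))⁻¹ * Real.exp (-x ^ 2 / 2)))
  simp only [sq_abs] at this
  rw [this]
  have h : ∀ x : ℝ, x ^ (c + 1) * ((Real.sqrt (2 * Real.pi))⁻¹ * Real.exp (-x ^ 2 / 2))
    = (Real.sqrt (2 * Real.pi))⁻¹ * (x ^ (c + 1) * Real.exp (-x ^ 2 / 2)) := fun x => by ring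
  simp_rw [h]
  rw [integral_const_mul]
  unfold Mom
  ring

theorem integral_rep_confluent_hypergeometric (lam c : ℝ)
    (hlam : lam ∈ Set.Icc (-1 : ℝ) 1) (hc : -1 < c) :
    (1 / Real.sqrt (2 * Real.pi)) *
        (∫ τ in Set.Ioi (0 : ℝ),
          τ ^ c * (Real.exp (-(τ - lam) ^ 2 / 2) - Real.exp (-(τ + lam) ^ 2 / 2))) =
      gaussNorm (c + 1) ^ (c + 1) * lam * oneF1 ((1 - c) / 2) (3 / 2) (-lam ^ 2 / 2) := by
  have h : ∀ τ : ℝ, τ ^ c * (Real.exp (-(τ - lam) ^ 2 / 2) - Real.exp (-(τ + lam) ^ 2 / 2))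
      = 2 * Real.exp (-(lam ^ 2 / 2)) * (τ ^ c * Real.exp (-τ ^ 2 / 2) * Real.sinh (lam * τ)) := by
    intro τ
    rw [Real.sinh_eq, show -(τ - lam) ^ 2 / 2 = -(lam ^ 2 / 2) + -τ ^ 2 / 2 + lam * τ by ring,
      show -(τ + lam) ^ 2 / 2 = -(lam ^ 2 / 2) + -τ ^ 2 / 2 + -(lam * τ) by ring]
    simp only [Real.exp_add]
    ring
  simp_rw [h]
  rw [integral_const_mul, sinh_int hc, gauss_eq hc,
    show (1 - c) / 2 = 3 / 2 - (c + 2) / 2 by ring, show -lam ^ 2 / 2 = -(lam ^ 2 / 2) by ring,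
    ← kummer (by linarith) (by norm_num) (by positivity)]
  ring
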